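/- Let D ⊂ ℝ³ be a bounded measurable set (with Lebesgue measure) and let the forcing coefficients satisfy assumption (A). Then Σ_{k=1}^∞ ( ∫_D f_k(x)·u(x) dx )² ≤ 2 ‖√ρ·u‖_{L²(D)}² ( C₁ ‖ρ‖_{L^γ(D)}^γ + C₂ ‖√ρ·u‖_{L²(D)}² ), where each integral ∫_D f_k·u dx is absolutely convergent. -/

import Mathlib

open MeasureTheory
open scoped RealInnerProductSpace

/-- Cauchy–Schwarz in the form `(∫ g)² ≤ ∫ w * ∫ a`, given the pointwise bound `g² ≤ w * a`. -/
theorem sq_integral_le_of_sq_le_mul {α : Type*} [MeasurableSpace α] {μ : Measure α}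
    {g w a : α → ℝ} (hg : Integrable g μ) (hw : Integrable w μ) (ha : Integrable a μ)
    (hw0 : ∀ x, 0 ≤ w x) (ha0 : ∀ x, 0 ≤ a x) (h : ∀ᵐ x ∂μ, g x ^ 2 ≤ w x * a x) :
    (∫ x, g x ∂μ) ^ 2 ≤ (∫ x, w x ∂μ) * ∫ x, a x ∂μ := by
  have key : ∀ t : ℝ, 0 ≤ (∫ x, w x ∂μ) * (t * t) + (2 * ∫ x, g x ∂μ) * t + ∫ x, a x ∂μ := by
    intro t
    have hint : ∫ x, (w x * (t * t) + (2 * g x) * t + a x) ∂μ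
        = (∫ x, w x ∂μ) * (t * t) + (2 * ∫ x, g x ∂μ) * t + ∫ x, a x ∂μ := by
      have hwg : Integrable (fun x => w x * (t * t) + (2 * g x) * t) μ :=
        (hw.mul_const _).add ((hg.const_mul 2).mul_const t)
      rw [integral_add hwg ha,
        integral_add (hw.mul_const _) ((hg.const_mul 2).mul_const t), integral_mul_const,
        integral_mul_const, integral_const_mul]
    rw [← hint]
    refine integral_nonneg_of_ae ?_
    filter_upwards [h] with x hx
    change 0 ≤ w x * (t * t) + (2 * g x) * t + a x
    rcases (hw0 x).eq_or_lt with h0 | h0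
    · have hg0 : g x = 0 := by
        rw [← h0, zero_mul] at hx
        exact pow_eq_zero_iff two_ne_zero |>.1 (le_antisymm hx (sq_nonneg _))
      simpa [← h0, hg0] using ha0 x
    · refine nonneg_of_mul_nonneg_right ?_ h0
      nlinarith [sq_nonneg (w x * t + g x)]
  have hd := discrim_le_zero key
  unfold discrim at hd
  linarith

/-- A square-summed Cauchy–Schwarz bound: if `g k ^ 2 ≤ w * a k` pointwise and `∑ k, a k ≤ B`, then
each `g k` is integrable and `∑ k, (∫ g k)² ≤ ∫ w * ∫ B`. -/
theorem summable_sq_integral_of_sq_le_mul {α : Type*} [MeasurableSpace α] {μ : Measure α}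
    {g a : ℕ → α → ℝ} {w B : α → ℝ} (hg : ∀ k, Measurable (g k)) (ha : ∀ k, Measurable (a k))
    (hw : Integrable w μ) (hB : Integrable B μ)
    (hw0 : ∀ x, 0 ≤ w x) (ha0 : ∀ k x, 0 ≤ a k x)
    (h : ∀ᵐ x ∂μ, ∀ k, g k x ^ 2 ≤ w x * a k x)
    (hsum : ∀ᵐ x ∂μ, ∀ s : Finset ℕ, ∑ k ∈ s, a k x ≤ B x) :
    (∀ k, Integrable (g k) μ) ∧ (Summable fun k => (∫ x, g k x ∂μ) ^ 2) ∧
      ∑' k, (∫ x, g k x ∂μ) ^ 2 ≤ (∫ x, w x ∂μ) * ∫ x, B x ∂μ := by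
  have hai : ∀ k, Integrable (a k) μ := fun k => by
    refine hB.mono' (ha k).aestronglyMeasurable ?_
    filter_upwards [hsum] with x hx
    simpa [abs_of_nonneg (ha0 k x)] using hx {k}
  have hgi : ∀ k, Integrable (g k) μ := fun k => by
    refine (hw.add (hai k)).mono' (hg k).aestronglyMeasurable ?_
    filter_upwards [h] with x hx
    rw [Real.norm_eq_abs, Pi.add_apply]
    refine abs_le_of_sq_le_sq ?_ (add_nonneg (hw0 x) (ha0 k x))
    nlinarith [hx k, hw0 x, ha0 k x, mul_nonneg (hw0 x) (ha0 k x)]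
  have hpart : ∀ s : Finset ℕ,
      ∑ k ∈ s, (∫ x, g k x ∂μ) ^ 2 ≤ (∫ x, w x ∂μ) * ∫ x, B x ∂μ := fun s =>
    calc ∑ k ∈ s, (∫ x, g k x ∂μ) ^ 2
        ≤ ∑ k ∈ s, (∫ x, w x ∂μ) * ∫ x, a k x ∂μ := Finset.sum_le_sum fun k _ =>
          sq_integral_le_of_sq_le_mul (hgi k) hw (hai k) hw0 (ha0 k) (h.mono fun x hx => hx k)
      _ = (∫ x, w x ∂μ) * ∫ x, ∑ k ∈ s, a k x ∂μ := by
          rw [← Finset.mul_sum, integral_finsetSum s fun k _ => hai k]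
      _ ≤ (∫ x, w x ∂μ) * ∫ x, B x ∂μ := by
          refine mul_le_mul_of_nonneg_left ?_ (integral_nonneg hw0)
          exact integral_mono_ae (integrable_finsetSum s fun k _ => hai k) hB
            (hsum.mono fun x hx => hx s)
  have hs := summable_of_sum_le (fun k => sq_nonneg (∫ x, g k x ∂μ)) hpart
  exact ⟨hgi, hs, hs.tsum_le_of_sum_le hpart⟩

/-- Pointwise weighted Cauchy–Schwarz for `⟪v + (c * r) • u, u⟫` with weight `r`. -/
theorem sq_inner_add_smul_le {E : Type*} [NormedAddCommGroup E] [InnerProductSpace ℝ E]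
    {r c : ℝ} {u v : E} (hr : 0 ≤ r) (hv : r = 0 → v = 0) :
    ⟪v + (c * r) • u, u⟫ ^ 2
      ≤ (r * ‖u‖ ^ 2) * (2 * (‖v‖ ^ 2 / r + c ^ 2 * (r * ‖u‖ ^ 2))) := by
  rcases hr.eq_or_lt with h0 | h0
  · simp [hv h0.symm, ← h0]
  · have h1 : ⟪v, u⟫ ^ 2 ≤ ‖v‖ ^ 2 * ‖u‖ ^ 2 := by
      rw [← mul_pow]
      exact sq_le_sq' (neg_le_of_abs_le (abs_real_inner_le_norm v u)) (real_inner_le_norm v u)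
    have h2 : (r * ‖u‖ ^ 2) * (2 * (‖v‖ ^ 2 / r + c ^ 2 * (r * ‖u‖ ^ 2)))
        = 2 * (‖v‖ ^ 2 * ‖u‖ ^ 2) + 2 * (c * r * ‖u‖ ^ 2) ^ 2 := by
      field_simp
    rw [h2, inner_add_left, real_inner_smul_left, real_inner_self_eq_norm_sq]
    nlinarith [sq_nonneg (⟪v, u⟫ - c * r * ‖u‖ ^ 2)]

/-- Under assumption (A) on a bounded measurable `D ⊂ ℝ³`, the forcing
coefficients `f_k := f_{k,1} + f_{k,2}·ρ·u` satisfy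
`Σ_k (∫_D f_k·u dx)² ≤ 2 ‖√ρ·u‖_{L²(D)}² (C₁ ‖ρ‖_{L^γ(D)}^γ + C₂ ‖√ρ·u‖_{L²(D)}²)`,
each integral `∫_D f_k·u dx` being absolutely convergent. -/
theorem stmt_1 (D : Set (EuclideanSpace ℝ (Fin 3))) (hD_meas : MeasurableSet D)
    (hD_bdd : Bornology.IsBounded D)
    (γ : ℝ) (hγ : 1 ≤ γ)
    (ρ : EuclideanSpace ℝ (Fin 3) → ℝ)
    (u : EuclideanSpace ℝ (Fin 3) → EuclideanSpace ℝ (Fin 3))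
    (hρ_meas : Measurable ρ) (hρ_nonneg : ∀ x, 0 ≤ ρ x) (hu_meas : Measurable u)
    (hρ_L1 : Integrable ρ (volume.restrict D))
    (hρ_Lγ : Integrable (fun x => ρ x ^ γ) (volume.restrict D))
    (hρu_L2 : Integrable (fun x => ρ x * ‖u x‖ ^ 2) (volume.restrict D))
    (C₁ C₂ : ℝ) (hC₁ : 0 ≤ C₁) (hC₂ : 0 ≤ C₂)
    (f₁ : ℕ → EuclideanSpace ℝ (Fin 3) → EuclideanSpace ℝ (Fin 3))
    (f₂ : ℕ → EuclideanSpace ℝ (Fin 3) → ℝ)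
    (hf₁_meas : ∀ k, Measurable (f₁ k)) (hf₂_meas : ∀ k, Measurable (f₂ k))
    (hf₁_bound : ∀ᵐ x ∂(volume.restrict D),
      (Summable fun k => ‖f₁ k x‖ ^ 2) ∧ ∑' k, ‖f₁ k x‖ ^ 2 ≤ C₁ * ρ x ^ (γ + 1))
    (hf₂_bound : ∀ᵐ x ∂(volume.restrict D),
      (Summable fun k => (f₂ k x) ^ 2) ∧ ∑' k, (f₂ k x) ^ 2 ≤ C₂) :
    (∀ k, Integrable (fun x => ⟪f₁ k x + (f₂ k x * ρ x) • u x, u x⟫)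
        (volume.restrict D)) ∧
    (Summable fun k =>
      (∫ x, ⟪f₁ k x + (f₂ k x * ρ x) • u x, u x⟫ ∂(volume.restrict D)) ^ 2) ∧
    ∑' k, (∫ x, ⟪f₁ k x + (f₂ k x * ρ x) • u x, u x⟫ ∂(volume.restrict D)) ^ 2
      ≤ 2 * (∫ x, ρ x * ‖u x‖ ^ 2 ∂(volume.restrict D)) *
        (C₁ * ∫ x, ρ x ^ γ ∂(volume.restrict D)
          + C₂ * ∫ x, ρ x * ‖u x‖ ^ 2 ∂(volume.restrict D)) := by
  have hγ0 : γ ≠ 0 := by linarith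
  have hB := ((hρ_Lγ.const_mul C₁).add (hρu_L2.const_mul C₂)).const_mul 2
  have key := summable_sq_integral_of_sq_le_mul (μ := volume.restrict D)
    (g := fun k x => ⟪f₁ k x + (f₂ k x * ρ x) • u x, u x⟫)
    (a := fun k x => 2 * (‖f₁ k x‖ ^ 2 / ρ x + f₂ k x ^ 2 * (ρ x * ‖u x‖ ^ 2)))
    (fun k => by have := hf₁_meas k; have := hf₂_meas k; fun_prop)
    (fun k => by have := hf₁_meas k; have := hf₂_meas k; fun_prop)
    hρu_L2 hB
    (fun x => mul_nonneg (hρ_nonneg x) (sq_nonneg _))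
    (fun k x => by have := hρ_nonneg x; positivity) ?_ ?_
  · refine ⟨key.1, key.2.1, key.2.2.trans_eq ?_⟩
    simp only [Pi.add_apply]
    rw [integral_const_mul, integral_add (hρ_Lγ.const_mul C₁) (hρu_L2.const_mul C₂),
      integral_const_mul, integral_const_mul]
    ring
  · filter_upwards [hf₁_bound] with x hx k
    refine sq_inner_add_smul_le (hρ_nonneg x) fun h0 => ?_
    have h1 := (hx.1.le_tsum k fun j _ => sq_nonneg _).trans hx.2
    rw [h0, Real.zero_rpow (by linarith), mul_zero] at h1
    exact norm_eq_zero.1 (pow_eq_zero_iff two_ne_zero |>.1 (le_antisymm h1 (sq_nonneg _)))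
  · filter_upwards [hf₁_bound, hf₂_bound] with x hx hy s
    have h1 := (hx.1.sum_le_tsum s fun j _ => sq_nonneg _).trans hx.2
    have h2 := (hy.1.sum_le_tsum s fun j _ => sq_nonneg _).trans hy.2
    simp only [Pi.add_apply]
    rw [← Finset.mul_sum, Finset.sum_add_distrib, ← Finset.sum_div, ← Finset.sum_mul]
    refine mul_le_mul_of_nonneg_left (add_le_add ?_ ?_) zero_le_two
    · rcases (hρ_nonneg x).eq_or_lt with h0 | h0
      · simp [← h0, Real.zero_rpow hγ0]
      · rw [div_le_iff₀ h0, mul_assoc, ← Real.rpow_add_one h0.ne']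
        exact h1
    · exact mul_le_mul_of_nonneg_right h2 (mul_nonneg (hρ_nonneg x) (sq_nonneg _))
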